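/- Let p be an odd prime, let f : ℤ_p → ℤ_p be everywhere analytic with integral coefficients, and let λ ∈ ℚ_p with ‖λ‖_p > 1. Then all Volkenborn integrals appearing below exist, the series converges, and the Stirling series holds: ∫_{ℤ_p} (λ+f(a))·(log_p(λ+f(a)) − 1) da = B_1^f(0) + Σ_{n=1}^∞ ((−1)^{n+1}/(n(n+1)))·B_{n+1}^f(0)·λ^{−n} + B_1^f(λ)·log_p(λ) − B_1^f(λ), where B_m^f(u) := ∫_{ℤ_p} (u+f(a))^m da. -/

import Mathlib

open Filter Topology

namespace PZeta

variable (p : ℕ) [Fact p.Prime]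

/-- The `N`-th partial sum defining the fermionic integral
`∫_{ℤ_p} g dμ₋₁ = lim_N Σ_{a=0}^{p^N-1} (-1)^a g(a)`. -/
noncomputable def fermSum (g : ℤ_[p] → ℚ_[p]) (N : ℕ) : ℚ_[p] :=
  ∑ a ∈ Finset.range (p ^ N), (-1 : ℚ_[p]) ^ a * g (a : ℤ_[p])

/-- The `N`-th partial sum defining the Volkenborn integral
`∫_{ℤ_p} g da = lim_N p^{-N} Σ_{a=0}^{p^N-1} g(a)`. -/
noncomputable def volkSum (g : ℤ_[p] → ℚ_[p]) (N : ℕ) : ℚ_[p] :=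
  ((p : ℚ_[p]) ^ N)⁻¹ * ∑ a ∈ Finset.range (p ^ N), g (a : ℤ_[p])

/-- The unit part `x·p^{-v_p(x)}` of a nonzero `p`-adic number. -/
noncomputable def unitPart (x : ℚ_[p]) : ℚ_[p] := x * (p : ℚ_[p]) ^ (-x.valuation)

/-- The Teichmüller representative of a `p`-adic unit, `lim_n x^{p^n}`. -/
noncomputable def teich (x : ℚ_[p]) : ℚ_[p] :=
  limUnder atTop fun n : ℕ => x ^ p ^ n

/-- The projection `⟨x⟩ ∈ 1 + pℤ_p`, via `x = p^{v_p(x)}·ζ·⟨x⟩`. -/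
noncomputable def angle (x : ℚ_[p]) : ℚ_[p] := unitPart p x / teich p (unitPart p x)

/-- `ω_v(x) := x / ⟨x⟩ = p^{v_p(x)}·ζ`. -/
noncomputable def omegaV (x : ℚ_[p]) : ℚ_[p] := x / angle p x

/-- The generalized binomial coefficient `C(t,n) = t(t-1)⋯(t-n+1)/n!`. -/
noncomputable def gbinom (t : ℚ_[p]) (n : ℕ) : ℚ_[p] :=
  (∏ i ∈ Finset.range n, (t - (i : ℚ_[p]))) / (n.factorial : ℚ_[p])

/-- The power `y^t` defined by the binomial series `Σ_n C(t,n)(y-1)^n`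
(used for `y ∈ 1 + pℤ_p` and `t ∈ ℤ_p`). -/
noncomputable def bpow (y t : ℚ_[p]) : ℚ_[p] := ∑' n : ℕ, gbinom p t n * (y - 1) ^ n

/-- The Iwasawa `p`-adic logarithm: `log_p x = Σ_{n≥1} (-1)^{n+1}(⟨x⟩-1)^n/n`
(one has `log_p p = 0` and `log_p ζ = 0` for roots of unity of order prime to `p`). -/
noncomputable def padicLog (x : ℚ_[p]) : ℚ_[p] :=
  ∑' n : ℕ, (-1 : ℚ_[p]) ^ n * (angle p x - 1) ^ (n + 1) / ((n : ℚ_[p]) + 1)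

/-- The power `y^t` defined by the exponential series `Σ_n (t·log_p y)^n/n!`
(used for `y ∈ 1 + pℤ_p` and `‖t‖ < p^{(p-2)/(p-1)}`). -/
noncomputable def epow (y t : ℚ_[p]) : ℚ_[p] :=
  ∑' n : ℕ, (t * padicLog p y) ^ n / (n.factorial : ℚ_[p])

/-- `f : ℤ_p → ℤ_p` is everywhere analytic with integral coefficients:
`f(x) = Σ_k c_k x^k` with `‖c_k‖ ≤ 1`, `c_k → 0`. -/
def EverywhereAnalytic (f : ℤ_[p] → ℤ_[p]) : Prop :=
  ∃ c : ℕ → ℚ_[p], (∀ k, ‖c k‖ ≤ 1) ∧ Tendsto c atTop (𝓝 0) ∧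
    ∀ x : ℤ_[p], (f x : ℚ_[p]) = ∑' k : ℕ, c k * (x : ℚ_[p]) ^ k

/-- The `p`-adic Hurwitz-type Euler zeta function w.r.t. `f`:
`ζ_{p,E}^f(s,λ) = ∫_{ℤ_p} ⟨λ+f(a)⟩^{1-s} dμ₋₁(a)`. -/
noncomputable def zetaE (f : ℤ_[p] → ℤ_[p]) (s : ℤ_[p]) (lam : ℚ_[p]) : ℚ_[p] :=
  limUnder atTop
    (fermSum p fun a => bpow p (angle p (lam + (f a : ℚ_[p]))) (1 - (s : ℚ_[p])))

/-- The `p`-adic Hurwitz zeta function w.r.t. `f`: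
`ζ_p^f(s,λ) = (s-1)⁻¹ ∫_{ℤ_p} ⟨λ+f(a)⟩^{1-s} da`. -/
noncomputable def zetaH (f : ℤ_[p] → ℤ_[p]) (s : ℤ_[p]) (lam : ℚ_[p]) : ℚ_[p] :=
  ((s : ℚ_[p]) - 1)⁻¹ *
    limUnder atTop
      (volkSum p fun a => bpow p (angle p (lam + (f a : ℚ_[p]))) (1 - (s : ℚ_[p])))

end PZeta

namespace PZeta

/-- `f` is strictly differentiable with derivative `f'`, with integral quadratic remainder. -/
def HasIntegralDeriv (p : ℕ) [Fact p.Prime] (f f' : ℤ_[p] → ℤ_[p]) : Prop :=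
  ∀ a h : ℤ_[p], h ^ 2 ∣ f (a + h) - f a - h * f' a

section IntegralDeriv

variable {p : ℕ} [Fact p.Prime] {f f' : ℤ_[p] → ℤ_[p]}

lemma HasIntegralDeriv.dvd_sub (hf : HasIntegralDeriv p f f') (a h : ℤ_[p]) :
    h ∣ f (a + h) - f a := by
  obtain ⟨k, hk⟩ := hf a h
  exact ⟨f' a + h * k, by linear_combination hk⟩

lemma HasIntegralDeriv.dvd_deriv_sub (hf : HasIntegralDeriv p f f') (a h : ℤ_[p]) :
    h ∣ f' (a + h) - f' a := by
  rcases eq_or_ne h 0 with rfl | h0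
  · simp
  obtain ⟨k, hk⟩ := hf a h
  obtain ⟨l, hl⟩ := hf (a + h) (-h)
  refine ⟨k + l, mul_left_cancel₀ h0 ?_⟩
  rw [add_neg_cancel_right] at hl
  linear_combination hk + hl

lemma HasIntegralDeriv.pow (hf : HasIntegralDeriv p f f') (m : ℕ) :
    HasIntegralDeriv p (fun x => f x ^ m) (fun x => m * f x ^ (m - 1) * f' x) := by
  intro a h
  obtain ⟨k, hk⟩ := hf a h
  obtain ⟨l, hl⟩ := Polynomial.powAddExpansion (f a) (h * f' a + h ^ 2 * k) m
  have e : f (a + h) = f a + (h * f' a + h ^ 2 * k) := by linear_combination hk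
  refine ⟨m * f a ^ (m - 1) * k + l * (f' a + h * k) ^ 2, ?_⟩
  simp only [e, hl]
  ring

lemma sum_range_mul_eq {M : Type*} [AddCommMonoid M] (g : ℕ → M) (q n : ℕ) :
    ∑ a ∈ Finset.range (q * n), g a =
      ∑ j ∈ Finset.range n, ∑ b ∈ Finset.range q, g (b + q * j) := by
  induction n with
  | zero => simp
  | succ n ih =>
    rw [mul_add, mul_one, Finset.sum_range_add, ih, Finset.sum_range_succ]
    simp only [add_comm]

lemma sum_range_pow_succ_sub (g : ℤ_[p] → ℤ_[p]) (N : ℕ) :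
    ∑ a ∈ Finset.range (p ^ (N + 1)), g a - p * ∑ a ∈ Finset.range (p ^ N), g a =
      ∑ j ∈ Finset.range p, ∑ b ∈ Finset.range (p ^ N), (g (b + p ^ N * j) - g b) := by
  rw [pow_succ, sum_range_mul_eq]
  simp [Finset.sum_sub_distrib]

/-- Sums of a 1-Lipschitz function over `0, …, p ^ N - 1` are almost divisible by `p ^ N`. -/
lemma pow_dvd_mul_sum {g : ℤ_[p] → ℤ_[p]} (hg : ∀ a h, h ∣ g (a + h) - g a) (N : ℕ) :
    (p : ℤ_[p]) ^ N ∣ p * ∑ a ∈ Finset.range (p ^ N), g a := by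
  induction N with
  | zero => simp
  | succ N ih =>
    have h1 : (p : ℤ_[p]) ^ N ∣ ∑ a ∈ Finset.range (p ^ (N + 1)), g a := by
      rw [← sub_add_cancel (∑ a ∈ Finset.range (p ^ (N + 1)), g a)
        (p * ∑ a ∈ Finset.range (p ^ N), g a), sum_range_pow_succ_sub]
      refine dvd_add (Finset.dvd_sum fun j _ => Finset.dvd_sum fun b _ => ?_) ih
      exact (Dvd.intro _ rfl).trans (hg _ _)
    rw [pow_succ']
    exact mul_dvd_mul_left _ h1

lemma HasIntegralDeriv.pow_dvd_sum_sub (hp : Odd p) (hf : HasIntegralDeriv p f f') (N : ℕ) :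
    (p : ℤ_[p]) ^ (2 * N) ∣
      ∑ a ∈ Finset.range (p ^ (N + 1)), f a - p * ∑ a ∈ Finset.range (p ^ N), f a := by
  rw [sum_range_pow_succ_sub]
  have h1 : (p : ℤ_[p]) ^ (2 * N) ∣
      ∑ j ∈ Finset.range p, ∑ b ∈ Finset.range (p ^ N), (p ^ N * (j : ℤ_[p]) * f' b) := by
    obtain ⟨k, hk⟩ := hp
    have h2 : ∑ j ∈ Finset.range p, (j : ℤ_[p]) = p * k := by
      have := Finset.sum_range_id_mul_two p
      have h3 : ∑ j ∈ Finset.range p, j = p * k := by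
        rw [show p - 1 = 2 * k by lia] at this
        linarith
      have := congrArg (Nat.cast : ℕ → ℤ_[p]) h3
      push_cast at this
      exact this
    have h4 : ∑ j ∈ Finset.range p, ∑ b ∈ Finset.range (p ^ N), (p ^ N * (j : ℤ_[p]) * f' b) =
        p ^ N * (p * ∑ b ∈ Finset.range (p ^ N), f' b) * k := by
      simp_rw [← Finset.mul_sum, ← Finset.sum_mul, ← Finset.mul_sum, h2]
      ring
    rw [h4, two_mul, pow_add]
    exact (mul_dvd_mul_left _ (pow_dvd_mul_sum hf.dvd_deriv_sub N)).mul_right _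
  rw [← dvd_sub_left h1, ← Finset.sum_sub_distrib]
  refine Finset.dvd_sum fun j _ => ?_
  rw [← Finset.sum_sub_distrib]
  refine Finset.dvd_sum fun b _ => ?_
  refine Dvd.dvd.trans ⟨(j : ℤ_[p]) ^ 2, ?_⟩ (hf b (p ^ N * j))
  ring

lemma volkSum_coe (g : ℤ_[p] → ℤ_[p]) (N : ℕ) :
    volkSum p (fun a => (g a : ℚ_[p])) N =
      ((p : ℚ_[p]) ^ N)⁻¹ * ((∑ a ∈ Finset.range (p ^ N), g a : ℤ_[p]) : ℚ_[p]) := by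
  simp [volkSum]

lemma volkSum_add (g h : ℤ_[p] → ℚ_[p]) (N : ℕ) :
    volkSum p (fun a => g a + h a) N = volkSum p g N + volkSum p h N := by
  simp only [volkSum, Finset.sum_add_distrib, mul_add]

lemma volkSum_const (c : ℚ_[p]) (N : ℕ) : volkSum p (fun _ => c) N = c := by
  have hp0 : (p : ℚ_[p]) ≠ 0 := by exact_mod_cast (Fact.out : p.Prime).ne_zero
  simp [volkSum, hp0]

lemma norm_volkSum_le {g : ℤ_[p] → ℤ_[p]} (hg : ∀ a h, h ∣ g (a + h) - g a) (N : ℕ) :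
    ‖volkSum p (fun a => (g a : ℚ_[p])) N‖ ≤ p := by
  have hp0 : (p : ℚ_[p]) ≠ 0 := by exact_mod_cast (Fact.out : p.Prime).ne_zero
  obtain ⟨t, ht⟩ := pow_dvd_mul_sum hg N
  have ht' : (p : ℚ_[p]) * ((∑ a ∈ Finset.range (p ^ N), g a : ℤ_[p]) : ℚ_[p]) = p ^ N * t := by
    exact_mod_cast congrArg (fun x : ℤ_[p] => (x : ℚ_[p])) ht
  have : volkSum p (fun a => (g a : ℚ_[p])) N = (p : ℚ_[p])⁻¹ * t := by
    rw [volkSum_coe]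
    field_simp
    linear_combination ht'
  rw [this, norm_mul, norm_inv, Padic.norm_p, inv_inv]
  exact mul_le_of_le_one_right (by positivity) t.norm_le_one

lemma HasIntegralDeriv.exists_tendsto_volkSum (hp : Odd p) (hf : HasIntegralDeriv p f f') :
    ∃ L, Tendsto (volkSum p fun a => (f a : ℚ_[p])) atTop (𝓝 L) := by
  have hp0 : (p : ℚ_[p]) ≠ 0 := by exact_mod_cast (Fact.out : p.Prime).ne_zero
  have hp1 : (1 : ℝ) < p := by exact_mod_cast (Fact.out : p.Prime).one_lt
  refine cauchySeq_tendsto_of_complete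
    (cauchySeq_of_le_geometric (p : ℝ)⁻¹ p (inv_lt_one_of_one_lt₀ hp1) fun N => ?_)
  obtain ⟨t, ht⟩ := hf.pow_dvd_sum_sub hp N
  have ht' : ((∑ a ∈ Finset.range (p ^ (N + 1)), f a : ℤ_[p]) : ℚ_[p]) -
      p * ((∑ a ∈ Finset.range (p ^ N), f a : ℤ_[p]) : ℚ_[p]) = p ^ (2 * N) * t := by
    exact_mod_cast congrArg (fun x : ℤ_[p] => (x : ℚ_[p])) ht
  rw [dist_comm, dist_eq_norm, volkSum_coe, volkSum_coe]
  have : ((p : ℚ_[p]) ^ (N + 1))⁻¹ * ((∑ a ∈ Finset.range (p ^ (N + 1)), f a : ℤ_[p]) : ℚ_[p]) -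
      ((p : ℚ_[p]) ^ N)⁻¹ * ((∑ a ∈ Finset.range (p ^ N), f a : ℤ_[p]) : ℚ_[p]) =
      (p : ℚ_[p])⁻¹ * p ^ N * t := by
    rw [pow_succ]
    field_simp
    rw [← pow_mul, mul_comm N 2]
    linear_combination ht'
  rw [this, norm_mul, norm_mul, norm_inv, norm_pow, Padic.norm_p, inv_inv]
  exact mul_le_of_le_one_right (by positivity) t.norm_le_one

lemma EverywhereAnalytic.exists_hasIntegralDeriv (hf : EverywhereAnalytic p f) :
    ∃ f', HasIntegralDeriv p f f' := by
  obtain ⟨c, hc1, hc0, hc⟩ := hf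
  obtain ⟨c, rfl⟩ : ∃ d : ℕ → ℤ_[p], c = fun k => (d k : ℚ_[p]) :=
    ⟨fun k => ⟨c k, hc1 k⟩, rfl⟩
  have hs : ∀ e : ℕ → ℤ_[p], Summable fun k => c k * e k := by
    intro e
    apply NonarchimedeanAddGroup.summable_of_tendsto_cofinite_zero
    rw [Nat.cofinite_eq_atTop]
    refine squeeze_zero_norm (fun k => ?_) (tendsto_zero_iff_norm_tendsto_zero.1 hc0)
    rw [norm_mul]
    exact mul_le_of_le_one_right (norm_nonneg _) (e k).norm_le_one
  have hfx : ∀ x, f x = ∑' k, c k * x ^ k := by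
    intro x
    apply PadicInt.ext
    rw [hc x]
    have := (hs fun k => x ^ k).hasSum.map (PadicInt.Coe.ringHom (p := p)).toAddMonoidHom
      continuous_subtype_val
    have h2 : ∑' k, ((c k * x ^ k : ℤ_[p]) : ℚ_[p]) = ((∑' k, c k * x ^ k : ℤ_[p]) : ℚ_[p]) :=
      this.tsum_eq
    simpa using h2
  refine ⟨fun x => ∑' k, c k * (k * x ^ (k - 1)), fun a h => ?_⟩
  choose e he using fun k : ℕ => (⟨_, (Polynomial.powAddExpansion a h k).2⟩ :
    ∃ e, (a + h) ^ k = a ^ k + k * a ^ (k - 1) * h + e * h ^ 2)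
  refine ⟨∑' k, c k * e k, ?_⟩
  rw [hfx, hfx, ← (hs _).tsum_mul_left, ← (hs _).tsum_mul_left, ← (hs _).tsum_sub (hs _),
    ← ((hs _).sub (hs _)).tsum_sub ((hs _).mul_left _)]
  refine tsum_congr fun k => ?_
  rw [he]
  ring

end IntegralDeriv

section Logarithm

variable {p : ℕ} [Fact p.Prime]

variable (p) in
/-- The power series `log (1 + y) = Σ (-1) ^ n * y ^ (n + 1) / (n + 1)`. -/
noncomputable def logOneAdd (y : ℚ_[p]) : ℚ_[p] :=
  ∑' n : ℕ, (-1 : ℚ_[p]) ^ n * y ^ (n + 1) / ((n : ℚ_[p]) + 1)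

lemma norm_inv_natCast_le (n : ℕ) : ‖((n : ℚ_[p]))⁻¹‖ ≤ n := by
  rcases Nat.eq_zero_or_pos n with rfl | hn
  · simp
  have hn0 : (n : ℚ_[p]) ≠ 0 := by exact_mod_cast hn.ne'
  rw [norm_inv, Padic.norm_eq_zpow_neg_valuation hn0, zpow_neg, inv_inv, Padic.valuation_natCast,
    zpow_natCast]
  exact_mod_cast Nat.le_of_dvd hn pow_padicValNat_dvd

lemma one_add_pow_prime_pow_tendsto {y : ℚ_[p]} (hy : ‖y‖ < 1) :
    Tendsto (fun n : ℕ => (1 + y) ^ p ^ n) atTop (𝓝 1) := by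
  obtain ⟨v, rfl⟩ : ∃ v : ℤ_[p], (v : ℚ_[p]) = y := ⟨⟨y, hy.le⟩, rfl⟩
  have hp1 : (1 : ℝ) < p := by exact_mod_cast (Fact.out : p.Prime).one_lt
  have hd : (p : ℤ_[p]) ∣ (1 + v) - 1 := by
    rw [← PadicInt.norm_lt_one_iff_dvd]
    simpa using hy
  rw [tendsto_iff_norm_sub_tendsto_zero]
  refine squeeze_zero (g := fun n : ℕ => (p : ℝ)⁻¹ ^ (n + 1)) (fun _ => norm_nonneg _)
    (fun n => ?_) ?_
  · have h := dvd_sub_pow_of_dvd_sub hd n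
    rw [← Ideal.mem_span_singleton, ← PadicInt.norm_le_pow_iff_mem_span_pow, one_pow] at h
    rw [PadicInt.norm_def, zpow_neg, zpow_natCast, ← inv_pow] at h
    simpa using h
  · exact (tendsto_add_atTop_iff_nat 1).2 (tendsto_pow_atTop_nhds_zero_of_lt_one (by positivity)
      (inv_lt_one_of_one_lt₀ hp1))

lemma natCast_choose_tendsto (k : ℕ) :
    Tendsto (fun n : ℕ => ((p ^ n - 1).choose k : ℚ_[p])) atTop (𝓝 ((-1) ^ k)) := by
  have hpow : Tendsto (fun n : ℕ => (p : ℚ_[p]) ^ n) atTop (𝓝 0) :=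
    tendsto_pow_atTop_nhds_zero_of_norm_lt_one Padic.norm_p_lt_one
  induction k with
  | zero => simp
  | succ k ih =>
    have hk : ((k : ℚ_[p]) + 1) ≠ 0 := by exact_mod_cast k.succ_ne_zero
    have h : ∀ n : ℕ, ((p ^ n - 1).choose (k + 1) : ℚ_[p]) =
        (p : ℚ_[p]) ^ n * (p ^ n - 1).choose k / (k + 1) - (p ^ n - 1).choose k := by
      intro n
      have hpn : p ^ n - 1 + 1 = p ^ n :=
        Nat.sub_add_cancel (Nat.one_le_pow _ _ (Fact.out : p.Prime).pos)
      have h1 := Nat.add_one_mul_choose_eq (p ^ n - 1) k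
      rw [Nat.choose_succ_succ, hpn] at h1
      have h2 : (p : ℚ_[p]) ^ n * (p ^ n - 1).choose k =
          ((p ^ n - 1).choose k + (p ^ n - 1).choose (k + 1)) * (k + 1) := by exact_mod_cast h1
      rw [h2]
      field_simp
      ring
    simp_rw [h]
    have := ((hpow.mul ih).div_const ((k : ℚ_[p]) + 1)).sub ih
    convert this using 2
    ring

lemma one_add_pow_sub_one_div_tendsto {y : ℚ_[p]} (hy : ‖y‖ < 1) :
    Tendsto (fun n : ℕ => ((1 + y) ^ p ^ n - 1) / (p : ℚ_[p]) ^ n) atTop (𝓝 (logOneAdd p y)) := by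
  have hp0 : (p : ℚ_[p]) ≠ 0 := by exact_mod_cast (Fact.out : p.Prime).ne_zero
  have h : ∀ n : ℕ, ((1 + y) ^ p ^ n - 1) / (p : ℚ_[p]) ^ n =
      ∑' k : ℕ, ((p ^ n - 1).choose k : ℚ_[p]) * y ^ (k + 1) / ((k : ℚ_[p]) + 1) := by
    intro n
    have hpn : p ^ n - 1 + 1 = p ^ n :=
        Nat.sub_add_cancel (Nat.one_le_pow _ _ (Fact.out : p.Prime).pos)
    rw [tsum_eq_sum (s := Finset.range (p ^ n)), add_comm 1 y, add_pow, Finset.sum_range_succ']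
    · simp only [pow_zero, one_pow, mul_one, Nat.choose_zero_right, Nat.cast_one, add_sub_cancel_right,
        Finset.sum_div]
      refine Finset.sum_congr rfl fun k _ => ?_
      have hk : ((k : ℚ_[p]) + 1) ≠ 0 := by exact_mod_cast k.succ_ne_zero
      have h1 := Nat.add_one_mul_choose_eq (p ^ n - 1) k
      rw [hpn] at h1
      have h2 : (p : ℚ_[p]) ^ n * (p ^ n - 1).choose k = (p ^ n).choose (k + 1) * (k + 1) := by
        exact_mod_cast h1
      field_simp
      linear_combination -y ^ (k + 1) * h2
    · intro k hk
      rw [Nat.choose_eq_zero_of_lt]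
      · simp
      · simp at hk; lia
  simp_rw [h]
  refine tendsto_tsum_of_dominated_convergence
    (bound := fun k : ℕ => ((k : ℝ) + 1) * ‖y‖ ^ (k + 1)) ?_
    (fun k => ((natCast_choose_tendsto k).mul_const _).div_const _)
    (Eventually.of_forall fun n k => ?_)
  · have := (summable_nat_add_iff 1).2
      (summable_pow_mul_geometric_of_norm_lt_one 1 (r := ‖y‖) (by simpa using hy))
    simpa using this
  · rw [div_eq_mul_inv, norm_mul, norm_mul, norm_pow, mul_comm ((k : ℝ) + 1)]
    gcongr
    · exact mul_le_of_le_one_left (by positivity) (IsUltrametricDist.norm_natCast_le_one _ _)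
    · exact_mod_cast norm_inv_natCast_le (p := p) (k + 1)

lemma logOneAdd_mul {x y z : ℚ_[p]} (hx : ‖x‖ < 1) (hy : ‖y‖ < 1) (hz : ‖z‖ < 1)
    (h : 1 + z = (1 + x) * (1 + y)) : logOneAdd p z = logOneAdd p x + logOneAdd p y := by
  refine tendsto_nhds_unique (one_add_pow_sub_one_div_tendsto hz) ?_
  have := ((one_add_pow_sub_one_div_tendsto hx).mul (one_add_pow_prime_pow_tendsto hy)).add
    (one_add_pow_sub_one_div_tendsto hy)
  rw [mul_one] at this
  refine this.congr fun n => ?_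
  rw [h, mul_pow]
  ring

lemma summable_logOneAdd {y : ℚ_[p]} (hy : ‖y‖ < 1) :
    Summable fun n : ℕ => (-1 : ℚ_[p]) ^ n * y ^ (n + 1) / ((n : ℚ_[p]) + 1) := by
  refine Summable.of_norm_bounded (g := fun k : ℕ => ((k : ℝ) + 1) * ‖y‖ ^ (k + 1)) ?_ fun k => ?_
  · have := (summable_nat_add_iff 1).2
      (summable_pow_mul_geometric_of_norm_lt_one 1 (r := ‖y‖) (by simpa using hy))
    simpa using this
  · rw [div_eq_mul_inv, norm_mul, norm_mul, norm_pow, norm_pow, mul_comm ((k : ℝ) + 1)]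
    gcongr
    · simp
    · exact_mod_cast norm_inv_natCast_le (p := p) (k + 1)

lemma hasSum_one_add_mul_logOneAdd {y : ℚ_[p]} (hy : ‖y‖ < 1) :
    HasSum (fun n : ℕ => (-1 : ℚ_[p]) ^ n / (((n : ℚ_[p]) + 1) * ((n : ℚ_[p]) + 2)) * y ^ (n + 2))
      ((1 + y) * logOneAdd p y - y) := by
  have hs := (summable_logOneAdd hy).hasSum
  have h1 := (hasSum_nat_add_iff' 1).2 hs
  have h2 := h1.add (hs.mul_left y)
  have e : (1 + y) * logOneAdd p y - y = logOneAdd p y - ∑ i ∈ Finset.range 1,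
      (-1 : ℚ_[p]) ^ i * y ^ (i + 1) / ((i : ℚ_[p]) + 1) + y * logOneAdd p y := by
    simp
    ring
  rw [e]
  refine h2.congr_fun fun n => ?_
  have h3 : ((n : ℚ_[p]) + 1) ≠ 0 := by exact_mod_cast n.succ_ne_zero
  have h4 : ((n : ℚ_[p]) + 2) ≠ 0 := by exact_mod_cast (n + 1).succ_ne_zero
  have h5 : ((n : ℚ_[p]) + 1 + 1) ≠ 0 := by exact_mod_cast (n + 1).succ_ne_zero
  push_cast
  field_simp
  ring

/-- Raising a `p`-adic unit to `p`-powers converges to a unit congruent to it. -/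
lemma exists_tendsto_pow_prime_pow {u : ℚ_[p]} (hu : ‖u‖ = 1) :
    ∃ t : ℚ_[p], ‖t‖ = 1 ∧ ‖u - t‖ < 1 ∧ Tendsto (fun n : ℕ => u ^ p ^ n) atTop (𝓝 t) := by
  obtain ⟨v, rfl⟩ : ∃ v : ℤ_[p], (v : ℚ_[p]) = u := ⟨⟨u, hu.le⟩, rfl⟩
  have hp1 : (1 : ℝ) < p := by exact_mod_cast (Fact.out : p.Prime).one_lt
  have hd : (p : ℤ_[p]) ∣ v ^ p - v := by
    rw [← PadicInt.norm_lt_one_iff_dvd, ← PadicInt.mem_nonunits, ← IsLocalRing.mem_maximalIdeal,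
      ← PadicInt.ker_toZMod, RingHom.mem_ker, map_sub, map_pow, ZMod.pow_card, sub_self]
  have hc : ∀ n : ℕ, dist (v ^ p ^ n) (v ^ p ^ (n + 1)) ≤ (p : ℝ)⁻¹ * (p : ℝ)⁻¹ ^ n := by
    intro n
    have h := dvd_sub_pow_of_dvd_sub hd n
    rw [← pow_mul, ← pow_succ', ← Ideal.mem_span_singleton,
      ← PadicInt.norm_le_pow_iff_mem_span_pow] at h
    rw [dist_comm, dist_eq_norm, ← pow_succ', inv_pow, ← zpow_natCast, ← zpow_neg]
    exact h
  obtain ⟨t, ht⟩ := cauchySeq_tendsto_of_complete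
    (cauchySeq_of_le_geometric _ _ (inv_lt_one_of_one_lt₀ hp1) hc)
  have hcl : ∀ n : ℕ, (p : ℤ_[p]) ∣ v - v ^ p ^ n := by
    intro n
    induction n with
    | zero => simp
    | succ n ih =>
      have h := dvd_sub_pow_of_dvd_sub hd n
      rw [← pow_mul, ← pow_succ'] at h
      have := dvd_sub ih ((dvd_pow_self _ n.succ_ne_zero).trans h)
      simpa using this
  refine ⟨t, ?_, ?_, ?_⟩
  · rw [← PadicInt.norm_def] at hu ⊢
    refine tendsto_nhds_unique (f := fun n : ℕ => ‖v ^ p ^ n‖) ht.norm ?_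
    simp [hu]
  · have h1 : ‖v - t‖ ≤ (p : ℝ)⁻¹ := by
      refine le_of_tendsto (tendsto_const_nhds.sub ht).norm (Eventually.of_forall fun n => ?_)
      have := (PadicInt.norm_le_pow_iff_mem_span_pow (v - v ^ p ^ n) 1).2
        (by simpa [Ideal.mem_span_singleton] using hcl n)
      simpa using this
    have := h1.trans_lt (inv_lt_one_of_one_lt₀ hp1)
    rwa [PadicInt.norm_def, PadicInt.coe_sub] at this
  · refine ((continuous_subtype_val.tendsto t).comp ht).congr fun n => ?_
    exact PadicInt.coe_pow v (p ^ n)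

lemma norm_unitPart {x : ℚ_[p]} (hx : x ≠ 0) : ‖unitPart p x‖ = 1 := by
  have hp0 : (p : ℝ) ≠ 0 := by exact_mod_cast (Fact.out : p.Prime).ne_zero
  rw [unitPart, norm_mul, norm_zpow, Padic.norm_p, Padic.norm_eq_zpow_neg_valuation hx, inv_zpow,
    ← zpow_neg, neg_neg, ← zpow_add₀ hp0, neg_add_cancel, zpow_zero]

lemma valuation_eq_of_norm_eq {x y : ℚ_[p]} (hx : x ≠ 0) (h : ‖x‖ = ‖y‖) :
    x.valuation = y.valuation := by
  have hp1 : (1 : ℝ) < p := by exact_mod_cast (Fact.out : p.Prime).one_lt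
  have hy : y ≠ 0 := norm_ne_zero_iff.1 (h ▸ norm_ne_zero_iff.2 hx)
  rw [Padic.norm_eq_zpow_neg_valuation hx, Padic.norm_eq_zpow_neg_valuation hy] at h
  exact neg_injective (zpow_right_injective₀ (by linarith) hp1.ne' h)

lemma norm_one_add {y : ℚ_[p]} (hy : ‖y‖ < 1) : ‖1 + y‖ = 1 := by
  rw [Padic.add_eq_max_of_ne (by simpa using hy.ne'), norm_one, max_eq_left hy.le]

lemma padicLog_mul_one_add {x y : ℚ_[p]} (hx : x ≠ 0) (hy : ‖y‖ < 1) :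
    padicLog p (x * (1 + y)) = padicLog p x + logOneAdd p y := by
  have hv : (x * (1 + y)).valuation = x.valuation :=
    (valuation_eq_of_norm_eq hx (by rw [norm_mul, norm_one_add hy, mul_one])).symm
  have hu : unitPart p (x * (1 + y)) = unitPart p x * (1 + y) := by
    rw [unitPart, hv, unitPart]
    ring
  obtain ⟨t, ht1, hut, ht⟩ := exists_tendsto_pow_prime_pow (norm_unitPart hx)
  have ht0 : t ≠ 0 := norm_ne_zero_iff.1 (ht1 ▸ one_ne_zero)
  have htx : teich p (unitPart p x) = t := ht.limUnder_eq
  have hty : teich p (unitPart p (x * (1 + y))) = t := by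
    rw [hu]
    refine Tendsto.limUnder_eq ?_
    simp_rw [mul_pow]
    simpa using ht.mul (one_add_pow_prime_pow_tendsto hy)
  have ha : angle p (x * (1 + y)) = angle p x * (1 + y) := by
    rw [angle, hty, hu, angle, htx]
    ring
  have hax : ‖angle p x - 1‖ < 1 := by
    rwa [angle, htx, div_sub_one ht0, norm_div, ht1, div_one]
  have haxy : ‖angle p (x * (1 + y)) - 1‖ < 1 := by
    rw [ha, show angle p x * (1 + y) - 1 = (angle p x - 1) * (1 + y) + y by ring]
    refine (Padic.nonarchimedean _ _).trans_lt (max_lt ?_ hy)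
    rwa [norm_mul, norm_one_add hy, mul_one]
  exact logOneAdd_mul hax hy haxy (by rw [add_sub_cancel, add_sub_cancel, ha])

end Logarithm

end PZeta

open PZeta

/-- Stirling's series for `log Γ_p^f`: all Volkenborn integrals
`L = ∫ (λ+f(a))(log_p(λ+f(a)) - 1) da`, `B_m^f(0) = ∫ f(a)^m da`, `B_1^f(λ) = ∫ (λ+f(a)) da`
exist, the series `Σ_{n≥1} ((-1)^{n+1}/(n(n+1))) B_{n+1}^f(0) λ^{-n}` (reindexed below with
`n ↦ n+1`) converges, and
`L = B_1^f(0) + Σ_{n≥1} ((-1)^{n+1}/(n(n+1))) B_{n+1}^f(0) λ^{-n} + B_1^f(λ)·log_p λ - B_1^f(λ)`. -/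
theorem logGammaH_stirling (p : ℕ) [Fact p.Prime] (hp : Odd p)
    (f : ℤ_[p] → ℤ_[p]) (hf : EverywhereAnalytic p f) (lam : ℚ_[p]) (hlam : 1 < ‖lam‖) :
    ∃ (L B1lam : ℚ_[p]) (B : ℕ → ℚ_[p]),
      Filter.Tendsto
        (volkSum p fun a =>
          (lam + (f a : ℚ_[p])) * (padicLog p (lam + (f a : ℚ_[p])) - 1))
        Filter.atTop (nhds L) ∧
      (∀ m : ℕ, Filter.Tendsto (volkSum p fun a => ((f a : ℚ_[p])) ^ m)
        Filter.atTop (nhds (B m))) ∧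
      Filter.Tendsto (volkSum p fun a => lam + (f a : ℚ_[p]))
        Filter.atTop (nhds B1lam) ∧
      Summable (fun n : ℕ =>
        (-1 : ℚ_[p]) ^ n / (((n : ℚ_[p]) + 1) * ((n : ℚ_[p]) + 2)) * B (n + 2) /
          lam ^ (n + 1)) ∧
      L = B 1
          + (∑' n : ℕ,
              (-1 : ℚ_[p]) ^ n / (((n : ℚ_[p]) + 1) * ((n : ℚ_[p]) + 2)) * B (n + 2) /
                lam ^ (n + 1))
          + B1lam * padicLog p lam - B1lam := by
  have hl0 : lam ≠ 0 := norm_pos_iff.1 (by linarith)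
  obtain ⟨f', hf'⟩ := hf.exists_hasIntegralDeriv
  have hex : ∀ m : ℕ, ∃ L, Tendsto (volkSum p fun a => (f a : ℚ_[p]) ^ m) atTop (𝓝 L) := by
    intro m
    simpa using (hf'.pow m).exists_tendsto_volkSum hp
  choose B hB using hex
  have hbd : ∀ m N : ℕ, ‖volkSum p (fun a => (f a : ℚ_[p]) ^ m) N‖ ≤ p := by
    intro m N
    simpa using norm_volkSum_le (hf'.pow m).dvd_sub N
  have hBbd : ∀ m, ‖B m‖ ≤ p := fun m =>
    le_of_tendsto (hB m).norm (Eventually.of_forall (hbd m))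
  have hB1 : Tendsto (volkSum p fun a => (f a : ℚ_[p])) atTop (𝓝 (B 1)) := by simpa using hB 1
  have hlamB : Tendsto (volkSum p fun a => lam + (f a : ℚ_[p])) atTop (𝓝 (lam + B 1)) := by
    refine (hB1.const_add lam).congr fun N => ?_
    rw [volkSum_add, volkSum_const]
  have hx : ∀ a, ‖(f a : ℚ_[p]) / lam‖ < 1 := by
    intro a
    rw [norm_div, div_lt_one (by linarith)]
    exact (f a).norm_le_one.trans_lt hlam
  set d : ℕ → ℚ_[p] := fun n => (-1 : ℚ_[p]) ^ n / (((n : ℚ_[p]) + 1) * ((n : ℚ_[p]) + 2)) with hd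
  have hpt : ∀ a, HasSum (fun n => d n * (f a : ℚ_[p]) ^ (n + 2) / lam ^ (n + 1))
      ((lam + f a) * (padicLog p (lam + f a) - 1) -
        (lam + f a) * (padicLog p lam - 1) - f a) := by
    intro a
    have h := (hasSum_one_add_mul_logOneAdd (hx a)).mul_left lam
    have e : lam + (f a : ℚ_[p]) = lam * (1 + f a / lam) := by field_simp
    have e2 : (lam + (f a : ℚ_[p])) * (padicLog p (lam + f a) - 1) -
        (lam + f a) * (padicLog p lam - 1) - f a =
        lam * ((1 + f a / lam) * logOneAdd p (f a / lam) - f a / lam) := by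
      rw [e, padicLog_mul_one_add hl0 (hx a)]
      field_simp
      ring
    rw [e2]
    refine h.congr_fun fun n => ?_
    rw [hd, div_pow, pow_succ lam (n + 1)]
    field_simp
  have hbound : ∀ (n : ℕ) (z : ℚ_[p]), ‖z‖ ≤ p → ‖d n * z / lam ^ (n + 1)‖ ≤
      ((n + 2 : ℕ) : ℝ) ^ 2 * (‖lam‖⁻¹) ^ (n + 2) * (p * ‖lam‖) := by
    intro n z hz
    have hdn : ‖d n‖ ≤ ((n + 2 : ℕ) : ℝ) ^ 2 := by
      have h1 := norm_inv_natCast_le (p := p) (n + 1)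
      have h2 := norm_inv_natCast_le (p := p) (n + 2)
      have : d n = (-1 : ℚ_[p]) ^ n * (((n + 1 : ℕ) : ℚ_[p])⁻¹ * ((n + 2 : ℕ) : ℚ_[p])⁻¹) := by
        simp only [hd]
        push_cast
        rw [div_eq_mul_inv, mul_inv]
      rw [this, norm_mul, norm_mul, norm_pow, norm_neg, norm_one, one_pow, one_mul, sq]
      refine mul_le_mul (h1.trans ?_) h2 (norm_nonneg _) (by positivity)
      push_cast
      linarith
    have hl : 0 < ‖lam‖ := by linarith
    rw [norm_div, norm_mul, norm_pow]
    have : ((n + 2 : ℕ) : ℝ) ^ 2 * (‖lam‖⁻¹) ^ (n + 2) * (p * ‖lam‖) =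
        ((n + 2 : ℕ) : ℝ) ^ 2 * p / ‖lam‖ ^ (n + 1) := by
      rw [inv_pow, pow_succ ‖lam‖ (n + 1)]
      field_simp
    rw [this]
    gcongr
  have hsb : Summable fun n : ℕ =>
      ((n + 2 : ℕ) : ℝ) ^ 2 * (‖lam‖⁻¹) ^ (n + 2) * (p * ‖lam‖) := by
    refine Summable.mul_right _ ((summable_nat_add_iff (f := fun n : ℕ => (n : ℝ) ^ 2 *
      (‖lam‖⁻¹) ^ n) 2).2 (summable_pow_mul_geometric_of_norm_lt_one 2 ?_))
    rw [norm_inv, norm_norm]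
    exact inv_lt_one_of_one_lt₀ hlam
  have hser := tendsto_tsum_of_dominated_convergence
    (f := fun N n => d n * volkSum p (fun a => (f a : ℚ_[p]) ^ (n + 2)) N / lam ^ (n + 1))
    (g := fun n => d n * B (n + 2) / lam ^ (n + 1)) (𝓕 := atTop) hsb
    (fun n => ((hB (n + 2)).const_mul _).div_const _)
    (Eventually.of_forall fun N n => hbound n _ (hbd _ N))
  refine ⟨_, lam + B 1, B, ?_, hB, hlamB,
    Summable.of_norm_bounded hsb fun n => hbound n _ (hBbd _), rfl⟩
  have key := ((hB1.add hser).add (hlamB.mul_const (padicLog p lam))).sub hlamB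
  refine key.congr fun N => ?_
  have hN : HasSum (fun n => d n * volkSum p (fun a => (f a : ℚ_[p]) ^ (n + 2)) N / lam ^ (n + 1))
      (volkSum p (fun a => (lam + f a) * (padicLog p (lam + f a) - 1) -
        (lam + f a) * (padicLog p lam - 1) - f a) N) := by
    have h := (hasSum_sum (s := Finset.range (p ^ N)) fun (a : ℕ) _ => hpt a).mul_left
      ((p : ℚ_[p]) ^ N)⁻¹
    refine h.congr_fun fun n => ?_
    rw [volkSum, ← Finset.sum_div, ← Finset.mul_sum]
    ring
  rw [hN.tsum_eq]
  simp only [volkSum, Finset.sum_sub_distrib, ← Finset.sum_mul]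
  ring
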